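/- Let G be a path-pairable simple graph on n vertices, let x be a vertex of G, and for i ≥ 0 let s_i denote the number of vertices at graph distance exactly i from x and u_i the number of vertices at distance at most i from x. Then for every ε > 0 there exists K such that for all k ≥ K, if u_{2k+1} ≤ n/2 then s_{2k} + s_{2k+1} ≥ (2 − ε)·k. -/

import Mathlib

/-- A simple graph is *path-pairable* if it has an even number of vertices and, for every
partition of its vertex set into unordered pairs (encoded as a fixed-point-free involution
`f`, pairing each vertex `v` with `f v`), there are paths joining each vertex to its pair
such that paths belonging to distinct pairs are pairwise edge-disjoint. -/
def SimpleGraph.PathPairable {V : Type*} (G : SimpleGraph V) : Prop :=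
  Even (Nat.card V) ∧
  ∀ f : V → V, Function.Involutive f → (∀ v, f v ≠ v) →
    ∃ P : (v : V) → G.Walk v (f v),
      (∀ v, (P v).IsPath) ∧
      ∀ v w, w ≠ v → w ≠ f v → ∀ e ∈ (P v).edges, e ∉ (P w).edges

theorem two_mul_add_one_le_add_of_sq_add_le_mul {k p q : ℕ} (hpos : 0 < p * q)
    (h : k ^ 2 + p ≤ p * q) : 2 * k + 1 ≤ p + q := by
  obtain ⟨r, rfl⟩ := Nat.exists_eq_succ_of_ne_zero (Nat.pos_of_mul_pos_left hpos).ne'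
  by_contra! hlt
  have h' : k ^ 2 ≤ p * r := by rw [Nat.mul_succ] at h; omega
  nlinarith [sq_nonneg ((p : ℤ) - r)]

/-- In a finite type of even size, the elements of a set containing at most half of the elements
can all be matched to elements outside the set by a fixed-point-free involution. -/
theorem exists_involutive_forall_mem_notMem {V : Type*} [Fintype V] (heven : Even (Fintype.card V))
    (A : Finset V) (hA : 2 * A.card ≤ Fintype.card V) :
    ∃ f : V → V, Function.Involutive f ∧ (∀ v, f v ≠ v) ∧ ∀ v ∈ A, f v ∉ A := by
  classical
  obtain ⟨m, hm⟩ := heven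
  obtain ⟨B, hAB, hB⟩ := Finset.exists_superset_card_eq (s := A) (n := m) (by omega) (by omega)
  have hBc : B.card = Bᶜ.card := by rw [Finset.card_compl]; omega
  let e : B ≃ (Bᶜ : Finset V) := Finset.equivOfCardEq hBc
  let f : V → V := fun v =>
    if h : v ∈ B then e ⟨v, h⟩ else e.symm ⟨v, Finset.mem_compl.mpr h⟩
  have hmem (v : V) (h : v ∈ B) : f v ∉ B := by
    simpa only [f, dif_pos h] using Finset.mem_compl.mp (e ⟨v, h⟩).2
  have hnotMem (v : V) (h : v ∉ B) : f v ∈ B := by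
    simp only [f, dif_neg h, Finset.coe_mem]
  refine ⟨f, fun v => ?_, fun v hv => ?_, fun v hv hfv => hmem v (hAB hv) (hAB hfv)⟩
  · by_cases h : v ∈ B
    · have := hmem v h
      simp only [f, dif_pos h] at this
      simp [f, h, this]
    · have := hnotMem v h
      simp only [f, dif_neg h] at this
      simp [f, h]
  · by_cases h : v ∈ B
    · exact hmem v h (hv.symm ▸ h)
    · exact h (hv ▸ hnotMem v h)

namespace SimpleGraph

variable {V : Type*} [Fintype V] {G : SimpleGraph V}

/-- In a path-pairable graph, every set `A` containing at most half of the vertices is left by at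
least `|A|` edges. -/
theorem PathPairable.exists_injOn_boundary (hpp : G.PathPairable) (A : Finset V)
    (hA : 2 * A.card ≤ Fintype.card V) :
    ∃ g : V → V × V, Set.InjOn g A ∧
      ∀ v ∈ A, (g v).1 ∈ A ∧ (g v).2 ∉ A ∧ G.Adj (g v).1 (g v).2 := by
  classical
  obtain ⟨heven, hpair⟩ := hpp
  rw [Nat.card_eq_fintype_card] at heven
  obtain ⟨f, hf, hne, hfA⟩ := exists_involutive_forall_mem_notMem heven A hA
  obtain ⟨P, -, hdisj⟩ := hpair f hf hne
  have hdart (v : V) : ∃ p : V × V, v ∈ A →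
      p.1 ∈ A ∧ p.2 ∉ A ∧ G.Adj p.1 p.2 ∧ s(p.1, p.2) ∈ (P v).edges := by
    by_cases hv : v ∈ A
    · obtain ⟨d, hd, hfst, hsnd⟩ := (P v).exists_boundary_dart (A : Set V) hv (hfA v hv)
      exact ⟨d.toProd, fun _ => ⟨hfst, hsnd, d.adj, List.mem_map_of_mem hd⟩⟩
    · exact ⟨(v, v), fun h => (hv h).elim⟩
  choose g hg using hdart
  refine ⟨g, fun v hv w hw hvw => ?_, fun v hv => ⟨(hg v hv).1, (hg v hv).2.1, (hg v hv).2.2.1⟩⟩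
  by_contra hne'
  refine hdisj v w (Ne.symm hne') (fun h => hfA v hv (h ▸ hw)) _ (hg v hv).2.2.2 ?_
  rw [hvw]
  exact (hg w hw).2.2.2

theorem PathPairable.connected [Nonempty V] (hpp : G.PathPairable) : G.Connected := by
  classical
  refine ⟨fun x y => ?_⟩
  by_contra hxy
  let C : Finset V := {v | G.Reachable x v}
  have hC {a b : V} (hab : G.Adj a b) : a ∈ C ↔ b ∈ C := by
    simp only [C, Finset.mem_filter_univ]
    exact ⟨fun h => h.trans hab.reachable, fun h => h.trans hab.symm.reachable⟩
  have hcard := Finset.card_add_card_compl C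
  rcases le_total C.card Cᶜ.card with h | h
  · obtain ⟨g, -, hg⟩ := hpp.exists_injOn_boundary C (by omega)
    obtain ⟨h₁, h₂, h₃⟩ := hg x (by simp [C])
    exact h₂ ((hC h₃).1 h₁)
  · obtain ⟨g, -, hg⟩ := hpp.exists_injOn_boundary Cᶜ (by omega)
    obtain ⟨h₁, h₂, h₃⟩ := hg y (by simpa [C] using hxy)
    simp only [Finset.mem_compl, not_not] at h₁ h₂
    exact h₁ ((hC h₃).2 h₂)

/-- In a path-pairable graph, the ball of radius `i` has at most as many vertices as there are
pairs between the layers `i` and `i + 1`, as long as it contains at most half of the vertices. -/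
theorem PathPairable.ncard_ball_le_mul (hpp : G.PathPairable) (x : V) (i : ℕ)
    (hi : 2 * {v : V | G.dist x v ≤ i}.ncard ≤ Fintype.card V) :
    {v : V | G.dist x v ≤ i}.ncard ≤
      {v : V | G.dist x v = i}.ncard * {v : V | G.dist x v = i + 1}.ncard := by
  classical
  have : Nonempty V := ⟨x⟩
  have hconn := hpp.connected
  let A : Finset V := {v | G.dist x v ≤ i}
  have hA : (A : Set V) = {v | G.dist x v ≤ i} := by simp [A]
  rw [← hA, Set.ncard_coe_finset] at hi
  obtain ⟨g, hinj, hg⟩ := hpp.exists_injOn_boundary A hi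
  rw [← Set.ncard_prod, ← hA]
  refine Set.ncard_le_ncard_of_injOn g (fun v hv => ?_) hinj
  obtain ⟨h₁, h₂, h₃⟩ := hg v hv
  simp only [A, Finset.mem_filter_univ] at h₁ h₂
  have h := hconn.dist_triangle (u := x) (v := (g v).1) (w := (g v).2)
  rw [dist_eq_one_iff_adj.2 h₃] at h
  simp only [Set.mem_prod, Set.mem_ofPred_eq]
  omega

theorem ncard_ball_succ (x : V) (i : ℕ) :
    {v : V | G.dist x v ≤ i + 1}.ncard =
      {v : V | G.dist x v ≤ i}.ncard + {v : V | G.dist x v = i + 1}.ncard := by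
  rw [← Set.ncard_union_eq]
  · congr 1
    ext v
    simp only [Set.mem_ofPred_eq, Set.mem_union]
    omega
  · rw [Set.disjoint_left]
    intro v h₁ h₂
    simp only [Set.mem_ofPred_eq] at h₁ h₂
    omega

theorem PathPairable.sq_add_ncard_layer_le_ncard_ball (hpp : G.PathPairable) (x : V) (k : ℕ)
    (hk : 2 * {v : V | G.dist x v ≤ 2 * k}.ncard ≤ Fintype.card V) :
    k ^ 2 + {v : V | G.dist x v = 2 * k}.ncard ≤ {v : V | G.dist x v ≤ 2 * k}.ncard := by
  induction k with
  | zero => simp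
  | succ k ih =>
    have h₁ := ncard_ball_succ (G := G) x (2 * k)
    have h₂ := ncard_ball_succ (G := G) x (2 * k + 1)
    rw [show 2 * (k + 1) = 2 * k + 1 + 1 from rfl] at hk ⊢
    have hk' : 2 * {v : V | G.dist x v ≤ 2 * k}.ncard ≤ Fintype.card V := by omega
    have h := ih hk'
    have hmul := hpp.ncard_ball_le_mul x (2 * k) hk'
    have hpos : 0 < {v : V | G.dist x v ≤ 2 * k}.ncard := (Set.ncard_pos).2 ⟨x, by simp⟩
    have := two_mul_add_one_le_add_of_sq_add_le_mul (hpos.trans_le hmul) (h.trans hmul)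
    nlinarith

/-- Consecutive layers of a path-pairable graph grow linearly, with no error term and uniformly in
the graph. -/
theorem PathPairable.two_mul_add_one_le_ncard_layer_add (hpp : G.PathPairable) (x : V) (k : ℕ)
    (hk : 2 * {v : V | G.dist x v ≤ 2 * k}.ncard ≤ Fintype.card V) :
    2 * k + 1 ≤ {v : V | G.dist x v = 2 * k}.ncard + {v : V | G.dist x v = 2 * k + 1}.ncard := by
  have hmul := hpp.ncard_ball_le_mul x (2 * k) hk
  have hpos : 0 < {v : V | G.dist x v ≤ 2 * k}.ncard := (Set.ncard_pos).2 ⟨x, by simp⟩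
  exact two_mul_add_one_le_add_of_sq_add_le_mul (hpos.trans_le hmul)
    ((hpp.sq_add_ncard_layer_le_ncard_ball x k hk).trans hmul)

end SimpleGraph

/-- **Lemma 3.** In a path-pairable graph on `n` vertices, for every `ε > 0` and all
sufficiently large `k`, the distance layers from a vertex `x` satisfy
`s (2k) + s (2k+1) ≥ (2-ε)·k` as long as `u (2k+1) ≤ n/2`. -/
theorem layers_grow_strong {V : Type*} [Fintype V] {G : SimpleGraph V} {n : ℕ}
    (hn : Fintype.card V = n) (hpp : G.PathPairable) (x : V)
    (s u : ℕ → ℕ)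
    (hs : ∀ i, s i = {v : V | G.dist x v = i}.ncard)
    (hu : ∀ i, u i = {v : V | G.dist x v ≤ i}.ncard) :
    ∀ ε : ℝ, 0 < ε → ∃ K : ℕ, ∀ k : ℕ, K ≤ k → 2 * u (2 * k + 1) ≤ n →
      (2 - ε) * (k : ℝ) ≤ ((s (2 * k) + s (2 * k + 1) : ℕ) : ℝ) := by
  subst hn
  intro ε hε
  refine ⟨0, fun k _ hk => ?_⟩
  have hsucc := SimpleGraph.ncard_ball_succ (G := G) x (2 * k)
  rw [hu] at hk
  have h := hpp.two_mul_add_one_le_ncard_layer_add x k (by omega)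
  rw [← hs, ← hs] at h
  have h' : (2 * k + 1 : ℝ) ≤ ((s (2 * k) + s (2 * k + 1) : ℕ) : ℝ) := by exact_mod_cast h
  nlinarith [mul_nonneg hε.le (Nat.cast_nonneg (α := ℝ) k)]
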